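/- Let n ≥ 3 and x ∈ Λ_n with x = b/d in lowest terms, and let p̃_{n,x} ∈ C_q^s(n,2) be the correlation induced by the canonical strategy S̃. Then p̃_{n,x} self-tests S̃: for every quantum strategy S = (ψ ∈ ℂ^{d_A} ⊗ ℂ^{d_B}, {P_v, I − P_v}_{v=1}^n, {Q_w, I − Q_w}_{w=1}^n) whose induced correlation equals p̃_{n,x}, the canonical strategy S̃ is a local dilation of S. -/

import Mathlib

open scoped Matrix Kronecker ComplexOrder

noncomputable section
namespace QST

/-- Euclidean norm of a finite complex vector. -/
def evnorm {ι : Type} [Fintype ι] (v : ι → ℂ) : ℝ :=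
  Real.sqrt (∑ i, ‖v i‖ ^ 2)

/-- Inner product `⟨v, w⟩`, linear in the first argument. -/
def pinner {ι : Type} [Fintype ι] (v w : ι → ℂ) : ℂ :=
  ∑ i, v i * (starRingEnd ℂ) (w i)

/-- Reduced density matrix of `ψψ*` on the first tensor factor. -/
def rhoA {dA dB : ℕ} (ψ : Fin dA × Fin dB → ℂ) : Matrix (Fin dA) (Fin dA) ℂ :=
  Matrix.of fun a a' => ∑ b, ψ (a, b) * (starRingEnd ℂ) (ψ (a', b))

/-- Reduced density matrix of `ψψ*` on the second tensor factor. -/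
def rhoB {dA dB : ℕ} (ψ : Fin dA × Fin dB → ℂ) : Matrix (Fin dB) (Fin dB) ℂ :=
  Matrix.of fun b b' => ∑ a, ψ (a, b) * (starRingEnd ℂ) (ψ (a, b'))

/-- The state-dependent seminorm `‖X‖_ρ = (tr (X* X ρ))^(1/2)`. -/
def rnorm {d : ℕ} (ρ X : Matrix (Fin d) (Fin d) ℂ) : ℝ :=
  Real.sqrt ((Xᴴ * X * ρ).trace).re

/-- Operator (spectral) norm of a matrix. -/
def opNorm {d : ℕ} (X : Matrix (Fin d) (Fin d) ℂ) : ℝ :=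
  ‖Matrix.toEuclideanCLM (𝕜 := ℂ) X‖

/-- `P = P* = P²`. -/
def IsProjection {d : ℕ} (P : Matrix (Fin d) (Fin d) ℂ) : Prop :=
  Pᴴ = P ∧ P * P = P

/-- 1-norm distance between correlations. -/
def dist1 {n k : ℕ} (p q : Fin n → Fin n → Fin k → Fin k → ℝ) : ℝ :=
  ∑ v, ∑ w, ∑ i, ∑ j, |p v w i j - q v w i j|

/-- Membership in the set `C_q(n,k)` of quantum correlations. -/
def IsQuantumCorrelation (n k : ℕ) (p : Fin n → Fin n → Fin k → Fin k → ℝ) : Prop :=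
  ∃ (dA dB : ℕ) (ψ : Fin dA × Fin dB → ℂ)
    (E : Fin n → Fin k → Matrix (Fin dA) (Fin dA) ℂ)
    (F : Fin n → Fin k → Matrix (Fin dB) (Fin dB) ℂ),
    evnorm ψ = 1 ∧ (∀ v i, (E v i).PosSemidef) ∧ (∀ v, ∑ i, E v i = 1) ∧
    (∀ w j, (F w j).PosSemidef) ∧ (∀ w, ∑ j, F w j = 1) ∧
    ∀ v w i j, (p v w i j : ℂ) = pinner ((E v i ⊗ₖ F w j).mulVec ψ) ψ

/-- Strategy 1 (the "tilde" strategy) is a local `ε`-dilation of strategy 2. -/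
def IsLocalDilation {n k : ℕ} (ε : ℝ) {d1A d1B d2A d2B : ℕ}
    (ψ1 : Fin d1A × Fin d1B → ℂ)
    (E1 : Fin n → Fin k → Matrix (Fin d1A) (Fin d1A) ℂ)
    (F1 : Fin n → Fin k → Matrix (Fin d1B) (Fin d1B) ℂ)
    (ψ2 : Fin d2A × Fin d2B → ℂ)
    (E2 : Fin n → Fin k → Matrix (Fin d2A) (Fin d2A) ℂ)
    (F2 : Fin n → Fin k → Matrix (Fin d2B) (Fin d2B) ℂ) : Prop :=
  ∃ (kA kB : ℕ) (VA : Matrix (Fin d1A × Fin kA) (Fin d2A) ℂ)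
    (VB : Matrix (Fin d1B × Fin kB) (Fin d2B) ℂ) (χ : Fin kA × Fin kB → ℂ),
    VAᴴ * VA = 1 ∧ VBᴴ * VB = 1 ∧ evnorm χ = 1 ∧
    evnorm (fun y : (Fin d1A × Fin d1B) × (Fin kA × Fin kB) =>
        ((VA ⊗ₖ VB).mulVec ψ2) ((y.1.1, y.2.1), (y.1.2, y.2.2)) - ψ1 y.1 * χ y.2) ≤ ε ∧
    ∀ (v w : Fin n) (i j : Fin k),
      evnorm (fun y : (Fin d1A × Fin d1B) × (Fin kA × Fin kB) =>
        ((VA ⊗ₖ VB).mulVec ((E2 v i ⊗ₖ F2 w j).mulVec ψ2)) ((y.1.1, y.2.1), (y.1.2, y.2.2))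
          - ((E1 v i ⊗ₖ F1 w j).mulVec ψ1) y.1 * χ y.2) ≤ ε

/-- The sequence generating `Λ_n` for `n ≥ 4`. -/
def lambdaSeq (n : ℕ) : ℕ → ℝ
  | 0 => 0
  | l + 1 => 1 + 1 / ((n : ℝ) - 1 - lambdaSeq n l)

/-- The sets `Λ_n`. -/
def Lambda (n : ℕ) : Set ℝ :=
  if n = 3 then {3 / 2} else Set.range (lambdaSeq n)

/-- The maximally entangled state `φ_d`. -/
def phid (d : ℕ) : Fin d × Fin d → ℂ :=
  fun y => if y.1 = y.2 then (((Real.sqrt d)⁻¹ : ℝ) : ℂ) else 0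

/-- The two-outcome measurement `{M, 1 - M}`. -/
def canonPair {d : ℕ} (M : Matrix (Fin d) (Fin d) ℂ) : Fin 2 → Matrix (Fin d) (Fin d) ℂ :=
  fun i => if i = 0 then M else 1 - M

def IsRep {n : ℕ} (x : ℂ) {H : Type} [AddCommGroup H] [Module ℂ H]
    (P : Fin n → H →ₗ[ℂ] H) : Prop :=
  (∀ v h, P v (P v h) = P v h) ∧ ∀ h, ∑ v, P v h = x • h

def UU (n : ℕ) (x : ℂ) : Prop :=
  ∀ (H K : Type) [AddCommGroup H] [Module ℂ H] [FiniteDimensional ℂ H] [Nontrivial H]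
    [AddCommGroup K] [Module ℂ K] [FiniteDimensional ℂ K] [Nontrivial K]
    (P : Fin n → H →ₗ[ℂ] H) (R : Fin n → K →ₗ[ℂ] K), IsRep x P → IsRep x R →
    ∃ X : H →ₗ[ℂ] K, X ≠ 0 ∧ ∀ v h, X (P v h) = R v (X h)

theorem trace_idem {H : Type} [AddCommGroup H] [Module ℂ H] [FiniteDimensional ℂ H]
    (P : H →ₗ[ℂ] H) (h : ∀ a, P (P a) = P a) :
    LinearMap.trace ℂ H P = (Module.finrank ℂ (LinearMap.range P) : ℂ) := by
  apply LinearMap.IsProj.trace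
  constructor
  · intro x; exact ⟨x, rfl⟩
  · rintro _ ⟨y, rfl⟩; exact h y

theorem rep_trace {n : ℕ} {x : ℂ} {H : Type} [AddCommGroup H] [Module ℂ H]
    [FiniteDimensional ℂ H] {P : Fin n → H →ₗ[ℂ] H} (h : IsRep x P) :
    ((∑ v, Module.finrank ℂ (LinearMap.range (P v)) : ℕ) : ℂ) = x * Module.finrank ℂ H := by
  have h1 : ∑ v, P v = x • LinearMap.id := by
    ext a; simpa using h.2 a
  have h2 := congrArg (LinearMap.trace ℂ H) h1
  rw [map_sum, map_smul, LinearMap.trace_id, smul_eq_mul] at h2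
  rw [← h2]
  push_cast
  exact Finset.sum_congr rfl fun v _ => (trace_idem (P v) (h.1 v)).symm

theorem rep_zero {n : ℕ} {H : Type} [AddCommGroup H] [Module ℂ H]
    [FiniteDimensional ℂ H] {P : Fin n → H →ₗ[ℂ] H} (h : IsRep 0 P) (v : Fin n) : P v = 0 := by
  have := rep_trace h
  rw [zero_mul] at this
  have h2 : ∑ v, Module.finrank ℂ (LinearMap.range (P v)) = 0 := by exact_mod_cast this
  have h3 := (Finset.sum_eq_zero_iff.mp h2) v (Finset.mem_univ _)
  have h4 := Submodule.finrank_eq_zero.mp h3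
  exact LinearMap.range_eq_bot.mp h4

theorem UU_zero (n : ℕ) : UU n 0 := by
  intro H K _ _ _ _ _ _ _ _ P R hP hR
  obtain ⟨X, hX⟩ := exists_ne (0 : H →ₗ[ℂ] K)
  exact ⟨X, hX, fun v h => by simp [rep_zero hP, rep_zero hR]⟩

theorem rep_compl {n : ℕ} {x : ℂ} {H : Type} [AddCommGroup H] [Module ℂ H]
    {P : Fin n → H →ₗ[ℂ] H} (h : IsRep x P) :
    IsRep ((n : ℂ) - x) (fun v => LinearMap.id - P v) := by
  constructor
  · intro v a; simp [h.1]
  · intro a; simp [h.2, sub_smul, Nat.cast_smul_eq_nsmul]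

theorem UU_compl {n : ℕ} {x : ℂ} (h : UU n x) : UU n ((n : ℂ) - x) := by
  intro H K _ _ _ _ _ _ _ _ P R hP hR
  have h1 := rep_compl hP
  have h2 := rep_compl hR
  rw [sub_sub_cancel] at h1 h2
  obtain ⟨X, hX, hc⟩ := h H K _ _ h1 h2
  refine ⟨X, hX, fun v a => ?_⟩
  have := hc v a
  simpa using this

section S
variable {n : ℕ} {x : ℂ} {H : Type} [AddCommGroup H] [Module ℂ H]

/-- the space of the reflected representation -/
def hatS (P : Fin n → H →ₗ[ℂ] H) : Submodule ℂ (Fin n → H) where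
  carrier := {h | (∀ v, P v (h v) = h v) ∧ ∑ v, h v = 0}
  add_mem' := by
    rintro a b ⟨ha, ha'⟩ ⟨hb, hb'⟩
    exact ⟨fun v => by simp [ha, hb], by simp [Finset.sum_add_distrib, ha', hb']⟩
  zero_mem' := ⟨fun v => by simp, by simp⟩
  smul_mem' := by
    rintro c a ⟨ha, ha'⟩
    exact ⟨fun v => by simp [ha], by simp [← Finset.smul_sum, ha']⟩

/-- the map `j_v` -/
def jS (P : Fin n → H →ₗ[ℂ] H) (hx : x ≠ 0) (hP : IsRep x P) (v : Fin n) : H →ₗ[ℂ] hatS P where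
  toFun h := ⟨fun w => (x / (x - 1)) • ((if v = w then P v h else 0) - x⁻¹ • P w (P v h)), by
    constructor
    · intro w
      by_cases hw : v = w
      · subst hw; simp [hP.1]
      · simp [hw, hP.1]
    · rw [← Finset.smul_sum, Finset.sum_sub_distrib, ← Finset.smul_sum, hP.2]
      simp [smul_smul, hx]⟩
  map_add' a b := by
    ext w; by_cases hw : v = w <;> simp [hw] <;> module
  map_smul' c a := by
    ext w; by_cases hw : v = w <;> simp [hw] <;> module

theorem jS_apply (P : Fin n → H →ₗ[ℂ] H) (hx : x ≠ 0) (hP : IsRep x P) (v w : Fin n) (h : H) :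
    (jS P hx hP v h).1 w = (x / (x - 1)) • ((if v = w then P v h else 0) - x⁻¹ • P w (P v h)) := rfl

theorem jS_self (P : Fin n → H →ₗ[ℂ] H) (hx : x ≠ 0) (hx1 : x - 1 ≠ 0) (hP : IsRep x P)
    (v : Fin n) (h : H) : (jS P hx hP v h).1 v = P v h := by
  rw [jS_apply]
  simp only [if_true, hP.1]
  have : x / (x - 1) * (1 - x⁻¹) = 1 := by field_simp
  calc _ = (x / (x - 1) * (1 - x⁻¹)) • P v h := by module
    _ = _ := by rw [this, one_smul]

/-- the reflected projections -/
def hatP (P : Fin n → H →ₗ[ℂ] H) (hx : x ≠ 0) (hP : IsRep x P) (v : Fin n) :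
    hatS P →ₗ[ℂ] hatS P :=
  jS P hx hP v ∘ₗ LinearMap.proj v ∘ₗ (hatS P).subtype

theorem hatP_apply (P : Fin n → H →ₗ[ℂ] H) (hx : x ≠ 0) (hP : IsRep x P) (v : Fin n)
    (h : hatS P) : hatP P hx hP v h = jS P hx hP v (h.1 v) := rfl

theorem jS_P (P : Fin n → H →ₗ[ℂ] H) (hx : x ≠ 0) (hP : IsRep x P) (v : Fin n) (h : H) :
    jS P hx hP v (P v h) = jS P hx hP v h := by
  ext w; simp [jS_apply, hP.1]

theorem hat_rep (P : Fin n → H →ₗ[ℂ] H) (hx : x ≠ 0) (hx1 : x - 1 ≠ 0) (hP : IsRep x P) :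
    IsRep (x / (x - 1)) (hatP P hx hP) := by
  constructor
  · intro v h
    rw [hatP_apply, hatP_apply, jS_self P hx hx1, h.2.1 v]
  · intro h
    ext w
    have e1 : ∀ v, P v (h.1 v) = h.1 v := h.2.1
    have e2 : ∑ v, h.1 v = 0 := h.2.2
    simp only [hatP_apply, Submodule.coe_sum, Finset.sum_apply, jS_apply, e1, Submodule.coe_smul,
      Pi.smul_apply]
    rw [← Finset.smul_sum, Finset.sum_sub_distrib, ← Finset.smul_sum, ← map_sum, e2]
    simp

theorem hat_nontrivial [Nontrivial H] (P : Fin n → H →ₗ[ℂ] H) (hx : x ≠ 0) (hx1 : x - 1 ≠ 0)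
    (hP : IsRep x P) : Nontrivial (hatS P) := by
  by_contra hc
  rw [not_nontrivial_iff_subsingleton] at hc
  obtain ⟨h, hh⟩ := exists_ne (0 : H)
  have h1 : ∀ v, P v h = 0 := by
    intro v
    rw [← jS_self P hx hx1 hP v h, Subsingleton.elim (jS P hx hP v h) 0]; rfl
  have := hP.2 h
  simp only [h1, Finset.sum_const_zero] at this
  exact (smul_ne_zero hx hh) this.symm

end S

theorem UU_refl {n : ℕ} {x : ℂ} (hx : x ≠ 0) (hx1 : x - 1 ≠ 0) (h : UU n (x / (x - 1))) :
    UU n x := by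
  intro H K _ _ _ _ _ _ _ _ P R hP hR
  have := hat_nontrivial P hx hx1 hP
  have := hat_nontrivial R hx hx1 hR
  obtain ⟨Y, hY0, hY⟩ := h (hatS P) (hatS R) _ _ (hat_rep P hx hx1 hP) (hat_rep R hx hx1 hR)
  -- the components
  let Z : Fin n → H →ₗ[ℂ] K := fun v =>
    LinearMap.proj v ∘ₗ (hatS R).subtype ∘ₗ Y ∘ₗ jS P hx hP v
  have Zdef : ∀ v a, Z v a = (Y (jS P hx hP v a)).1 v := fun v a => rfl
  have hZP : ∀ v a, Z v (P v a) = Z v a := by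
    intro v a; rw [Zdef, jS_P, Zdef]
  have hRZ : ∀ v a, R v (Z v a) = Z v a := fun v a => (Y (jS P hx hP v a)).2.1 v
  have hYc : ∀ (g : hatS P) v, (Y g).1 v = Z v (g.1 v) := by
    intro g v
    have h1 := hY v g
    rw [hatP_apply, hatP_apply] at h1
    rw [Zdef, h1, jS_self R hx hx1 hR]
    exact ((Y g).2.1 v).symm
  have hxx : x / (x - 1) ≠ 0 := div_ne_zero hx hx1
  have key : ∀ v w a, R w (Z v a) = Z w (P w (P v a)) := by
    intro v w a
    by_cases hvw : v = w
    · subst hvw; rw [hP.1, hZP, hRZ]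
    · have h1 := hY v (jS P hx hP v a)
      rw [hatP_apply, hatP_apply, jS_self P hx hx1 hP, jS_P, ← Zdef] at h1
      have h2 := congrArg (fun g => g.1 w) h1
      change (Y (jS P hx hP v a)).1 w = (jS R hx hR v (Z v a)).1 w at h2
      rw [hYc, jS_apply, jS_apply, if_neg hvw, if_neg hvw, hRZ, map_smul] at h2
      have h3 := smul_right_injective K hxx h2
      simp only [zero_sub, map_neg, map_smul, neg_inj] at h3
      exact (smul_right_injective K (inv_ne_zero hx) h3).symm
  have key2 : ∀ w a, ∑ v, Z v (P v (P w a)) = x • Z w a := by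
    intro w a
    have h1 : ∑ v, (Y (jS P hx hP w a)).1 v = 0 := (Y (jS P hx hP w a)).2.2
    simp only [hYc, jS_apply, map_smul, map_sub] at h1
    rw [← Finset.smul_sum, Finset.sum_sub_distrib, ← Finset.smul_sum] at h1
    have h2 := (smul_eq_zero.mp h1).resolve_left hxx
    have h3 : ∑ v, Z v (if w = v then P w a else 0) = Z w (P w a) := by
      rw [Finset.sum_eq_single w]
      · simp
      · intro b _ hb; simp [hb.symm]
      · simp
    rw [h3, hZP, sub_eq_zero] at h2
    rw [h2, smul_smul, mul_inv_cancel₀ hx, one_smul]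
  let X : H →ₗ[ℂ] K := ∑ v, Z v
  have Xd : ∀ a, X a = ∑ v, Z v a := by intro a; simp [X]
  have hRX : ∀ w a, R w (X a) = x • Z w a := by
    intro w a
    rw [Xd, map_sum]
    simp only [key]
    rw [← map_sum, ← map_sum, hP.2, map_smul, map_smul, hZP]
  refine ⟨X, ?_, ?_⟩
  · intro hX
    apply hY0
    ext g v
    rw [hYc]
    have := hRX v (g.1 v)
    rw [hX, LinearMap.zero_apply, map_zero] at this
    exact (smul_eq_zero.mp this.symm).resolve_left hx
  · intro w a
    rw [hRX, Xd, ← key2]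
    simp only [hZP]

theorem UU_step {n : ℕ} {x : ℂ} (h : UU n x) (h1 : (n : ℂ) - 1 - x ≠ 0) (h2 : (n : ℂ) - x ≠ 0) :
    UU n (1 + 1 / ((n : ℂ) - 1 - x)) := by
  have e : 1 + 1 / ((n : ℂ) - 1 - x) = ((n : ℂ) - x) / ((n : ℂ) - 1 - x) := by
    field_simp; ring
  have e2 : 1 + 1 / ((n : ℂ) - 1 - x) - 1 = 1 / ((n : ℂ) - 1 - x) := by ring
  apply UU_refl
  · rw [e]; exact div_ne_zero h2 h1
  · rw [e2]; exact one_div_ne_zero h1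
  · rw [e2, e]
    have : ((n : ℂ) - x) / ((n : ℂ) - 1 - x) / (1 / ((n : ℂ) - 1 - x)) = (n : ℂ) - x := by
      field_simp
    rw [this]
    exact UU_compl h


theorem lambdaSeq_bd {n : ℕ} (hn : 4 ≤ n) (l : ℕ) : lambdaSeq n l ≤ 2 := by
  have hn' : (4 : ℝ) ≤ n := by exact_mod_cast hn
  induction l with
  | zero => simp [lambdaSeq]
  | succ l ih =>
    rw [lambdaSeq]
    have h1 : 1 / ((n : ℝ) - 1 - lambdaSeq n l) ≤ 1 := by
      rw [div_le_one] <;> linarith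
    linarith

theorem UU_seq {n : ℕ} (hn : 4 ≤ n) (l : ℕ) : UU n ((lambdaSeq n l : ℝ) : ℂ) := by
  have hn' : (4 : ℝ) ≤ n := by exact_mod_cast hn
  induction l with
  | zero => simpa [lambdaSeq] using UU_zero n
  | succ l ih =>
    have hb := lambdaSeq_bd hn l
    have := UU_step ih (by
      have : (n : ℝ) - 1 - lambdaSeq n l ≠ 0 := by intro h; linarith
      exact_mod_cast this) (by
      have : (n : ℝ) - lambdaSeq n l ≠ 0 := by intro h; linarith
      exact_mod_cast this)
    rw [lambdaSeq]
    push_cast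
    exact this

theorem UU_Lambda {n : ℕ} (hn : 3 ≤ n) {x : ℝ} (hx : x ∈ Lambda n) : UU n (x : ℂ) := by
  unfold Lambda at hx
  split_ifs at hx with h3
  · subst h3
    rw [Set.mem_singleton_iff] at hx
    subst hx
    have := UU_step (UU_zero 3) (by norm_num) (by norm_num)
    convert this using 1
    norm_num
  · obtain ⟨l, rfl⟩ := hx
    exact UU_seq (by omega) l

/-- restriction of a family of matrices to an invariant subspace -/
def resP {n D : ℕ} (P : Fin n → Matrix (Fin D) (Fin D) ℂ) (W : Submodule ℂ (Fin D → ℂ))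
    (hW : ∀ v, ∀ h ∈ W, P v *ᵥ h ∈ W) (v : Fin n) : W →ₗ[ℂ] W :=
  (P v).mulVecLin.restrict (hW v)

theorem resP_coe {n D : ℕ} (P : Fin n → Matrix (Fin D) (Fin D) ℂ) (W : Submodule ℂ (Fin D → ℂ))
    (hW : ∀ v, ∀ h ∈ W, P v *ᵥ h ∈ W) (v : Fin n) (h : W) :
    (resP P W hW v h : Fin D → ℂ) = P v *ᵥ (h : Fin D → ℂ) := rfl

theorem resP_rep {n D : ℕ} {x : ℂ} (P : Fin n → Matrix (Fin D) (Fin D) ℂ)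
    (W : Submodule ℂ (Fin D → ℂ))
    (hW : ∀ v, ∀ h ∈ W, P v *ᵥ h ∈ W) (h1 : ∀ v, ∀ h ∈ W, P v *ᵥ (P v *ᵥ h) = P v *ᵥ h)
    (h2 : ∀ h ∈ W, ∑ v, P v *ᵥ h = x • h) : IsRep x (resP P W hW) := by
  constructor
  · intro v h
    apply Subtype.ext
    rw [resP_coe, resP_coe, h1 v _ h.2]
  · intro h
    apply Subtype.ext
    rw [Submodule.coe_sum]
    simp only [resP_coe]
    rw [h2 _ h.2]; rfl

theorem schur {n b d : ℕ} {x : ℝ} (hd : 0 < d) (hcop : Nat.Coprime b d) (hbd : x = (b : ℝ) / d)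
    (Pt : Fin n → Matrix (Fin d) (Fin d) ℂ)
    (hPt : ∀ v, Pt v * Pt v = Pt v) (hPtsum : ∑ v, Pt v = (x : ℂ) • 1)
    (C : Matrix (Fin d) (Fin d) ℂ) (hC : ∀ v, Pt v * C = C * Pt v) : ∃ c : ℂ, C = c • 1 := by
  have : Nonempty (Fin d) := ⟨⟨0, hd⟩⟩
  obtain ⟨c, hc⟩ := Module.End.exists_eigenvalue (C.mulVecLin : Module.End ℂ (Fin d → ℂ))
  refine ⟨c, ?_⟩
  set W := Module.End.eigenspace (C.mulVecLin : Module.End ℂ (Fin d → ℂ)) c with hWd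
  have hmem : ∀ h, h ∈ W ↔ C *ᵥ h = c • h := by
    intro h; rw [hWd, Module.End.mem_eigenspace_iff]; rfl
  have hW : ∀ v, ∀ h ∈ W, Pt v *ᵥ h ∈ W := by
    intro v h hh
    rw [hmem] at hh ⊢
    rw [Matrix.mulVec_mulVec, ← hC, ← Matrix.mulVec_mulVec, hh, Matrix.mulVec_smul]
  have hr : IsRep (x : ℂ) (resP Pt W hW) := by
    apply resP_rep
    · intro v h _; rw [Matrix.mulVec_mulVec, hPt]
    · intro h _; rw [← Matrix.sum_mulVec, hPtsum, Matrix.smul_mulVec, Matrix.one_mulVec]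
  have ht := rep_trace hr
  set m := ∑ v, Module.finrank ℂ (LinearMap.range (resP Pt W hW v))
  have hdd : (d : ℂ) ≠ 0 := by exact_mod_cast hd.ne'
  have h3 : d * m = b * Module.finrank ℂ W := by
    rw [hbd] at ht
    push_cast at ht
    have : (d : ℂ) * m = b * Module.finrank ℂ W := by
      rw [ht]; field_simp
    exact_mod_cast this
  have h4 : d ∣ Module.finrank ℂ W := hcop.symm.dvd_of_dvd_mul_left ⟨m, h3.symm⟩
  have hWne : W ≠ ⊥ := hc
  have h5 : 0 < Module.finrank ℂ W := Nat.pos_of_ne_zero fun h => hWne (Submodule.finrank_eq_zero.mp h)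
  have h6 : Module.finrank ℂ W ≤ d := by
    simpa using Submodule.finrank_le W
  have h7 : Module.finrank ℂ W = d := le_antisymm h6 (Nat.le_of_dvd h5 h4)
  have h8 : W = ⊤ := Submodule.eq_top_of_finrank_eq (by simpa using h7)
  apply Matrix.ext_of_mulVec_single
  intro i
  have : Pi.single i (1 : ℂ) ∈ W := by rw [h8]; trivial
  rw [(hmem _).1 this, Matrix.smul_mulVec, Matrix.one_mulVec]

theorem decomp {n d D : ℕ} {x : ℂ} (hd : 0 < d) (hU : UU n x)
    (Pt : Fin n → Matrix (Fin d) (Fin d) ℂ) (hPth : ∀ v, (Pt v)ᴴ = Pt v)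
    (hPt : ∀ v, Pt v * Pt v = Pt v) (hPtsum : ∑ v, Pt v = x • 1)
    (hS : ∀ C : Matrix (Fin d) (Fin d) ℂ, (∀ v, Pt v * C = C * Pt v) → ∃ c : ℂ, C = c • 1)
    (P : Fin n → Matrix (Fin D) (Fin D) ℂ) (hPh : ∀ v, (P v)ᴴ = P v) (N : ℕ) :
    ∀ (W : Submodule ℂ (Fin D → ℂ)) (_ : Module.finrank ℂ W ≤ N)
    (_ : ∀ v, ∀ h ∈ W, P v *ᵥ h ∈ W) (_ : ∀ v, ∀ h ∈ W, P v *ᵥ (P v *ᵥ h) = P v *ᵥ h)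
    (_ : ∀ h ∈ W, ∑ v, P v *ᵥ h = x • h),
    ∃ (k : ℕ) (X : Fin k → Matrix (Fin D) (Fin d) ℂ),
      (∀ i j, (X i)ᴴ * X j = if i = j then 1 else 0) ∧ (∀ v i, P v * X i = X i * Pt v) ∧
      (∀ i h, X i *ᵥ h ∈ W) ∧ (∀ h ∈ W, h = ∑ i, X i *ᵥ ((X i)ᴴ *ᵥ h)) := by
  have : Nonempty (Fin d) := ⟨⟨0, hd⟩⟩
  induction N with
  | zero =>
    intro W hN hW h1 h2
    have : W = ⊥ := Submodule.finrank_eq_zero.mp (by omega)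
    refine ⟨0, Fin.elim0, fun i => i.elim0, fun _ i => i.elim0, fun i => i.elim0, ?_⟩
    intro h hh
    rw [this, Submodule.mem_bot] at hh
    simp [hh]
  | succ N ih =>
    intro W hN hW h1 h2
    by_cases hWb : W = ⊥
    · refine ⟨0, Fin.elim0, fun i => i.elim0, fun _ i => i.elim0, fun i => i.elim0, ?_⟩
      intro h hh
      rw [hWb, Submodule.mem_bot] at hh
      simp [hh]
    have : Nontrivial W := Submodule.nontrivial_iff_ne_bot.mpr hWb
    have hrP := resP_rep P W hW h1 h2
    have hrt : IsRep x (fun v => (Pt v).mulVecLin) := by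
      constructor
      · intro v h; simp [Matrix.mulVec_mulVec, hPt]
      · intro h
        simp only [Matrix.mulVecLin_apply]
        rw [← Matrix.sum_mulVec, hPtsum, Matrix.smul_mulVec, Matrix.one_mulVec]
    obtain ⟨Y, hY0, hY⟩ := hU (Fin d → ℂ) W _ _ hrt hrP
    let Z : Matrix (Fin D) (Fin d) ℂ := LinearMap.toMatrix' (W.subtype ∘ₗ Y)
    have hZ : ∀ h, Z *ᵥ h = (Y h : Fin D → ℂ) := by
      intro h
      rw [← Matrix.toLin'_apply, Matrix.toLin'_toMatrix']; rfl
    have hZ0 : Z ≠ 0 := by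
      intro h0
      apply hY0
      ext1 h
      apply LinearMap.ext
      intro a
      apply Subtype.ext
      change (Y _ : Fin D → ℂ) = 0
      rw [← hZ, h0, Matrix.zero_mulVec]
    have hZc : ∀ v, P v * Z = Z * Pt v := by
      intro v
      apply Matrix.ext_of_mulVec_single
      intro i
      rw [← Matrix.mulVec_mulVec, ← Matrix.mulVec_mulVec, hZ, hZ]
      have := hY v (Pi.single i 1)
      rw [Matrix.mulVecLin_apply] at this
      rw [this, resP_coe]
    have hadj : ∀ T : Matrix (Fin D) (Fin d) ℂ, (∀ v, P v * T = T * Pt v) →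
        ∀ v, Tᴴ * P v = Pt v * Tᴴ := by
      intro T hT v
      have := congrArg Matrix.conjTranspose (hT v)
      rwa [Matrix.conjTranspose_mul, Matrix.conjTranspose_mul, hPh, hPth] at this
    obtain ⟨c, hc⟩ := hS (Zᴴ * Z) (by
      intro v
      rw [← Matrix.mul_assoc, ← hadj Z hZc, Matrix.mul_assoc, hZc, Matrix.mul_assoc])
    have hps := Matrix.posSemidef_conjTranspose_mul_self Z
    rw [hc] at hps
    have hc0 : 0 ≤ c := by
      have := hps.diag_nonneg (i := (⟨0, hd⟩ : Fin d))
      simpa using this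
    have hcne : c ≠ 0 := by
      rintro rfl
      rw [zero_smul, Matrix.conjTranspose_mul_self_eq_zero] at hc
      exact hZ0 hc
    obtain ⟨r, hr0, rfl⟩ : ∃ r : ℝ, 0 ≤ r ∧ (r : ℂ) = c := by
      refine ⟨c.re, (Complex.le_def.mp hc0).1, ?_⟩
      apply Complex.ext
      · simp
      · simpa using (Complex.le_def.mp hc0).2
    have hrne : r ≠ 0 := by exact_mod_cast hcne
    let T : Matrix (Fin D) (Fin d) ℂ := (((Real.sqrt r)⁻¹ : ℝ) : ℂ) • Z
    have hTT : Tᴴ * T = 1 := by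
      simp only [T, Matrix.conjTranspose_smul, Matrix.smul_mul, Matrix.mul_smul, hc, smul_smul]
      have : star (((Real.sqrt r)⁻¹ : ℝ) : ℂ) = (((Real.sqrt r)⁻¹ : ℝ) : ℂ) := Complex.conj_ofReal _
      rw [this, ← Complex.ofReal_mul, ← Complex.ofReal_mul]
      have h9 : (√r)⁻¹ * ((√r)⁻¹ * r) = 1 := by
        have := Real.mul_self_sqrt hr0
        have h0 : √r ≠ 0 := by rwa [Ne, Real.sqrt_eq_zero hr0]
        field_simp
        rw [sq, this]
      rw [h9]; simp
    have hTc : ∀ v, P v * T = T * Pt v := by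
      intro v; simp [T, hZc]
    have hTW : ∀ h, T *ᵥ h ∈ W := by
      intro h
      simp only [T, Matrix.smul_mulVec, hZ]
      exact W.smul_mem _ (Y h).2
    let W' : Submodule ℂ (Fin D → ℂ) := W ⊓ LinearMap.ker (Tᴴ).mulVecLin
    have hW' : ∀ h, h ∈ W' ↔ h ∈ W ∧ Tᴴ *ᵥ h = 0 := fun h => Iff.rfl
    have hlt : W' < W := by
      refine lt_of_le_of_ne inf_le_left ?_
      intro he
      have h3 : T *ᵥ (Pi.single ⟨0, hd⟩ 1) ∈ W' := by rw [he]; exact hTW _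
      have h4 := ((hW' _).1 h3).2
      rw [Matrix.mulVec_mulVec, hTT, Matrix.one_mulVec] at h4
      have := congrFun h4 ⟨0, hd⟩
      simp at this
    have hfr := Submodule.finrank_lt_finrank_of_lt hlt
    obtain ⟨k, X, g1, g2, g3, g4⟩ := ih W' (by omega)
      (by
        intro v h hh
        rw [hW'] at hh ⊢
        refine ⟨hW v h hh.1, ?_⟩
        rw [Matrix.mulVec_mulVec, hadj T hTc, ← Matrix.mulVec_mulVec, hh.2, Matrix.mulVec_zero])
      (fun v h hh => h1 v h hh.1) (fun h hh => h2 h hh.1)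
    have hTX : ∀ i, Tᴴ * X i = 0 := by
      intro i
      apply Matrix.ext_of_mulVec_single
      intro j
      rw [← Matrix.mulVec_mulVec, ((hW' _).1 (g3 i _)).2, Matrix.zero_mulVec]
    have hXT : ∀ i, (X i)ᴴ * T = 0 := by
      intro i
      have := congrArg Matrix.conjTranspose (hTX i)
      simpa using this
    refine ⟨k + 1, Fin.cons T X, ?_, ?_, ?_, ?_⟩
    · intro i j
      refine Fin.cases ?_ (fun i => ?_) i <;> refine Fin.cases ?_ (fun j => ?_) j
      · simp [hTT]
      · simp [hTX, (Fin.succ_ne_zero j).symm]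
      · simp [hXT]
      · simp [g1]
    · intro v i
      refine Fin.cases ?_ (fun i => ?_) i
      · simpa using hTc v
      · simpa using g2 v i
    · intro i h
      refine Fin.cases ?_ (fun i => ?_) i
      · simpa using hTW h
      · simpa using (g3 i h).1
    · intro h hh
      rw [Fin.sum_univ_succ]
      simp only [Fin.cons_zero, Fin.cons_succ]
      have h5 : h - T *ᵥ (Tᴴ *ᵥ h) ∈ W' := by
        rw [hW']
        refine ⟨W.sub_mem hh (hTW _), ?_⟩
        rw [Matrix.mulVec_sub, Matrix.mulVec_mulVec, hTT, Matrix.one_mulVec, sub_self]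
      have h6 := g4 _ h5
      simp only [Matrix.mulVec_sub] at h6
      have h7 : ∀ i, (X i)ᴴ *ᵥ (T *ᵥ (Tᴴ *ᵥ h)) = 0 := by
        intro i; rw [Matrix.mulVec_mulVec, hXT, Matrix.zero_mulVec]
      simp only [h7, Matrix.mulVec_zero, sub_zero] at h6
      rw [← h6]; abel

/-- matrix version of the decomposition -/
theorem decompM {n d D E : ℕ} {x : ℂ} (hd : 0 < d) (hU : UU n x)
    (Pt : Fin n → Matrix (Fin d) (Fin d) ℂ) (hPth : ∀ v, (Pt v)ᴴ = Pt v)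
    (hPt : ∀ v, Pt v * Pt v = Pt v) (hPtsum : ∑ v, Pt v = x • 1)
    (hS : ∀ C : Matrix (Fin d) (Fin d) ℂ, (∀ v, Pt v * C = C * Pt v) → ∃ c : ℂ, C = c • 1)
    (P : Fin n → Matrix (Fin D) (Fin D) ℂ) (hPh : ∀ v, (P v)ᴴ = P v)
    (M : Matrix (Fin D) (Fin E) ℂ) (R : Fin n → Matrix (Fin E) (Fin E) ℂ)
    (h0 : ∀ v, P v * M = M * R v)
    (h1 : ∀ v, P v * (P v * M) = P v * M) (h2 : (∑ v, P v) * M = x • M) :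
    ∃ (k : ℕ) (X : Fin k → Matrix (Fin D) (Fin d) ℂ),
      (∀ i j, (X i)ᴴ * X j = if i = j then 1 else 0) ∧ (∀ v i, P v * X i = X i * Pt v) ∧
      M = ∑ i, X i * ((X i)ᴴ * M) := by
  obtain ⟨k, X, g1, g2, -, g4⟩ := decomp hd hU Pt hPth hPt hPtsum hS P hPh _
    (LinearMap.range M.mulVecLin) le_rfl
    (by
      rintro v _ ⟨a, rfl⟩
      refine ⟨R v *ᵥ a, ?_⟩
      simp [Matrix.mulVec_mulVec, h0])
    (by
      rintro v _ ⟨a, rfl⟩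
      rw [Matrix.mulVecLin_apply, Matrix.mulVec_mulVec a, Matrix.mulVec_mulVec a, h1])
    (by
      rintro _ ⟨a, rfl⟩
      rw [Matrix.mulVecLin_apply, ← Matrix.sum_mulVec, Matrix.mulVec_mulVec, h2,
        Matrix.smul_mulVec])
  refine ⟨k, X, g1, g2, ?_⟩
  apply Matrix.ext_of_mulVec_single
  intro i
  have := g4 (M *ᵥ Pi.single i 1) ⟨_, rfl⟩
  simp only [Matrix.mulVec_mulVec] at this
  rw [Matrix.sum_mulVec]
  simpa only [Matrix.mul_assoc] using this

theorem kron_mulVec {p q : ℕ} {ι κ : Type} [Fintype ι] [Fintype κ]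
    (A : Matrix ι (Fin p) ℂ) (B : Matrix κ (Fin q) ℂ) (ψ : Fin p × Fin q → ℂ) (a : ι) (b : κ) :
    ((A ⊗ₖ B).mulVec ψ) (a, b) = (A * (Matrix.of fun i j => ψ (i, j)) * Bᵀ) a b := by
  simp only [Matrix.mulVec, dotProduct, Matrix.kroneckerMap_apply, Fintype.sum_prod_type,
    Matrix.mul_apply, Matrix.of_apply, Matrix.transpose_apply, Finset.sum_mul]
  rw [Finset.sum_comm]
  refine Finset.sum_congr rfl fun j _ => Finset.sum_congr rfl fun i _ => ?_
  ring

theorem pinner_trace {p q : ℕ} (u w : Fin p × Fin q → ℂ) :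
    pinner u w = ((Matrix.of fun i j => u (i, j)) * (Matrix.of fun i j => w (i, j))ᴴ).trace := by
  simp [pinner, Matrix.trace, Matrix.mul_apply, Fintype.sum_prod_type]

theorem iso_ext {k d D : ℕ} (hd : 0 < d) (X : Fin k → Matrix (Fin D) (Fin d) ℂ)
    (hX : ∀ i j, (X i)ᴴ * X j = if i = j then 1 else 0) :
    ∃ (K : ℕ) (V : Matrix (Fin d × Fin K) (Fin D) ℂ) (e : Fin k → Fin K), Vᴴ * V = 1 ∧
      ∀ i, V * X i = Matrix.of fun p t => if p.1 = t ∧ p.2 = e i then 1 else 0 := by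
  let S : Matrix (Fin D) (Fin D) ℂ := ∑ i, X i * (X i)ᴴ
  let G : Matrix (Fin D) (Fin D) ℂ := 1 - S
  have hSX : ∀ i, S * X i = X i := by
    intro i
    have : S * X i = ∑ j, X j * ((X j)ᴴ * X i) := by
      change (∑ j, X j * (X j)ᴴ) * X i = _
      rw [Matrix.sum_mul]
      exact Finset.sum_congr rfl fun j _ => Matrix.mul_assoc _ _ _
    rw [this]
    rw [Finset.sum_eq_single i]
    · simp [hX]
    · intro b _ hb; simp [hX, hb]
    · simp
  have hSS : S * S = S := by
    have : S * S = ∑ i, S * X i * (X i)ᴴ := by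
      conv_lhs => enter [2]; change ∑ i, X i * (X i)ᴴ
      rw [Matrix.mul_sum]
      exact Finset.sum_congr rfl fun j _ => (Matrix.mul_assoc _ _ _).symm
    rw [this]; simp only [hSX]; rfl
  have hSh : Sᴴ = S := by
    simp [S, Matrix.conjTranspose_sum]
  have hGG : Gᴴ * G = G := by
    simp only [G, Matrix.conjTranspose_sub, Matrix.conjTranspose_one, hSh, Matrix.mul_sub,
      Matrix.sub_mul, hSS, Matrix.mul_one, Matrix.one_mul]
    abel
  have hGX : ∀ i, G * X i = 0 := by
    intro i; simp only [G, Matrix.sub_mul, hSX, Matrix.one_mul, sub_self]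
  let s0 : Fin d := ⟨0, hd⟩
  let V : Matrix (Fin d × Fin (k + D)) (Fin D) ℂ := Matrix.of fun p a =>
    Fin.addCases (motive := fun _ => ℂ) (fun i => (X i)ᴴ p.1 a)
      (fun q => if p.1 = s0 then G q a else 0) p.2
  refine ⟨k + D, V, Fin.castAdd D, ?_, ?_⟩
  · ext a a'
    have e1 : (Vᴴ * V) a a' = S a a' + (Gᴴ * G) a a' := by
      simp only [Matrix.mul_apply, Matrix.conjTranspose_apply, Fintype.sum_prod_type,
        Fin.sum_univ_add, V, Matrix.of_apply, Fin.addCases_left, Fin.addCases_right,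
        Finset.sum_add_distrib, S, Matrix.sum_apply]
      congr 1
      · rw [Finset.sum_comm]
        simp
      · rw [Finset.sum_eq_single s0]
        · simp
        · intro b _ hb; simp [hb]
        · simp
    rw [e1, hGG]
    simp [G]
  · intro i
    ext ⟨s, m⟩ t
    refine Fin.addCases (fun j => ?_) (fun q => ?_) m
    · have := congrFun (congrFun (hX j i) s) t
      rw [Matrix.mul_apply] at this ⊢
      simp only [V, Matrix.of_apply, Fin.addCases_left]
      rw [this]
      by_cases hji : j = i
      · subst hji; simp [Matrix.one_apply]
      · simp [hji]
    · have := congrFun (congrFun (hGX i) q) t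
      rw [Matrix.mul_apply] at this ⊢
      simp only [V, Matrix.of_apply, Fin.addCases_right]
      have hne : Fin.natAdd k q ≠ Fin.castAdd D i := by
        intro h; have := congrArg Fin.val h; simp at this; omega
      by_cases hs : s = s0
      · simp only [hs, if_true, this]; simp [hne]
      · simp [hs, hne]

theorem JGJ {d K L : ℕ} (G : Matrix (Fin d) (Fin d) ℂ) (m : Fin K) (l : Fin L)
    (p : Fin d × Fin K) (q : Fin d × Fin L) :
    ((Matrix.of fun (p : Fin d × Fin K) (t : Fin d) => if p.1 = t ∧ p.2 = m then (1 : ℂ) else 0) * G *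
      (Matrix.of fun (p : Fin d × Fin L) (t : Fin d) => if p.1 = t ∧ p.2 = l then (1 : ℂ) else 0)ᵀ) p q
      = G p.1 q.1 * (if p.2 = m ∧ q.2 = l then 1 else 0) := by
  by_cases h1 : p.2 = m <;> by_cases h2 : q.2 = l <;>
    simp [Matrix.mul_apply, h1, h2]

theorem phid_mat (d : ℕ) : (Matrix.of fun i j => phid d (i, j)) =
    (((Real.sqrt d)⁻¹ : ℝ) : ℂ) • (1 : Matrix (Fin d) (Fin d) ℂ) := by
  ext i j
  simp [phid, Matrix.one_apply]

theorem canon_mul {d D : ℕ} {P : Matrix (Fin D) (Fin D) ℂ} {Pt : Matrix (Fin d) (Fin d) ℂ}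
    {X : Matrix (Fin D) (Fin d) ℂ} (h : P * X = X * Pt) (i : Fin 2) :
    canonPair P i * X = X * canonPair Pt i := by
  unfold canonPair
  split_ifs
  · exact h
  · rw [Matrix.sub_mul, Matrix.mul_sub, h, Matrix.one_mul, Matrix.mul_one]

theorem canon_mul' {d D : ℕ} {P : Matrix (Fin D) (Fin D) ℂ} {Pt : Matrix (Fin d) (Fin d) ℂ}
    {X : Matrix (Fin d) (Fin D) ℂ} (h : X * P = Pt * X) (i : Fin 2) :
    X * canonPair P i = canonPair Pt i * X := by
  unfold canonPair
  split_ifs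
  · exact h
  · rw [Matrix.sub_mul, Matrix.mul_sub, h, Matrix.one_mul, Matrix.mul_one]

theorem canon_transpose {d : ℕ} (P : Matrix (Fin d) (Fin d) ℂ) (i : Fin 2) :
    (canonPair P i)ᵀ = canonPair Pᵀ i := by
  unfold canonPair; split_ifs <;> simp

theorem evnorm_one_iff {ι : Type} [Fintype ι] (v : ι → ℂ) :
    evnorm v = 1 ↔ ∑ i, v i * (starRingEnd ℂ) (v i) = 1 := by
  have h1 : ∑ i, v i * (starRingEnd ℂ) (v i) = ((∑ i, ‖v i‖ ^ 2 : ℝ) : ℂ) := by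
    push_cast
    exact Finset.sum_congr rfl fun i _ => Complex.mul_conj' _
  rw [h1, evnorm, Real.sqrt_eq_one]
  exact_mod_cast Iff.rfl

theorem psd_zero {p q : ℕ} {A : Matrix (Fin p) (Fin p) ℂ} {B : Matrix (Fin q) (Fin q) ℂ}
    (hA : A.PosSemidef) (hB : B.PosSemidef) (ψ : Fin p × Fin q → ℂ)
    (h : pinner ((A ⊗ₖ B).mulVec ψ) ψ = 0) : A * (Matrix.of fun i j => ψ (i, j)) * Bᵀ = 0 := by
  have h1 := (hA.kronecker hB).dotProduct_mulVec_zero_iff ψ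
  have h2 : star ψ ⬝ᵥ (A ⊗ₖ B) *ᵥ ψ = 0 := by
    rw [← h, pinner, dotProduct]
    exact Finset.sum_congr rfl fun i _ => by simp [mul_comm]
  have h3 := h1.1 h2
  ext a b
  rw [← kron_mulVec, h3]; rfl
theorem statement11 {n b d : ℕ} (hn : 3 ≤ n) (x : ℝ) (hx : x ∈ Lambda n)
    (hd : 0 < d) (hcop : Nat.Coprime b d) (hbd : x = (b : ℝ) / d)
    (Pt : Fin n → Matrix (Fin d) (Fin d) ℂ)
    (hPt : ∀ v, IsProjection (Pt v)) (hPtsum : ∑ v, Pt v = (x : ℂ) • 1)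
    {dA dB : ℕ} (ψ : Fin dA × Fin dB → ℂ)
    (P : Fin n → Matrix (Fin dA) (Fin dA) ℂ)
    (Q : Fin n → Matrix (Fin dB) (Fin dB) ℂ)
    (hψ : evnorm ψ = 1)
    (hP : ∀ v, (P v).PosSemidef ∧ (1 - P v).PosSemidef)
    (hQ : ∀ w, (Q w).PosSemidef ∧ (1 - Q w).PosSemidef)
    (hcorr : ∀ (v w : Fin n) (i j : Fin 2),
      pinner ((canonPair (P v) i ⊗ₖ canonPair (Q w) j).mulVec ψ) ψ =
        pinner ((canonPair (Pt v) i ⊗ₖ canonPair ((Pt w)ᵀ) j).mulVec (phid d))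
          (phid d)) :
    IsLocalDilation 0 (phid d) (fun v i => canonPair (Pt v) i)
      (fun w j => canonPair ((Pt w)ᵀ) j) ψ (fun v i => canonPair (P v) i)
      (fun w j => canonPair (Q w) j) := by
  have hPth : ∀ v, (Pt v)ᴴ = Pt v := fun v => (hPt v).1
  have hPti : ∀ v, Pt v * Pt v = Pt v := fun v => (hPt v).2
  have hU := UU_Lambda hn hx
  have hS := schur hd hcop hbd Pt hPti hPtsum
  have hPh : ∀ v, (P v)ᴴ = P v := fun v => (hP v).1.isHermitian
  have hQh : ∀ v, ((Q v)ᵀ)ᴴ = (Q v)ᵀ := fun v => (hQ v).1.isHermitian.transpose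
  set M : Matrix (Fin dA) (Fin dB) ℂ := Matrix.of fun i j => ψ (i, j) with hM
  have hd0 : (d : ℝ) ≠ 0 := by exact_mod_cast hd.ne'
  have hdc : (d : ℂ) ≠ 0 := by exact_mod_cast hd.ne'
  have hsq : (((Real.sqrt d)⁻¹ : ℝ) : ℂ) * (((Real.sqrt d)⁻¹ : ℝ) : ℂ) = (d : ℂ)⁻¹ := by
    rw [← Complex.ofReal_mul, ← mul_inv, Real.mul_self_sqrt (Nat.cast_nonneg d)]
    push_cast; rfl
  -- correlations as traces
  have hR : ∀ v w i j, pinner ((canonPair (Pt v) i ⊗ₖ canonPair ((Pt w)ᵀ) j).mulVec (phid d))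
      (phid d) = (d : ℂ)⁻¹ * (canonPair (Pt v) i * canonPair (Pt w) j).trace := by
    intro v w i j
    rw [pinner_trace]
    simp only [kron_mulVec]
    rw [phid_mat, canon_transpose, Matrix.transpose_transpose]
    have : ∀ N : Matrix (Fin d) (Fin d) ℂ, (Matrix.of fun i j => N i j) = N := fun N => rfl
    rw [this]
    simp only [Matrix.conjTranspose_smul, Matrix.conjTranspose_one, Matrix.mul_smul,
      Matrix.smul_mul, Matrix.mul_one, Matrix.trace_smul, smul_eq_mul]
    have h1 : star (((Real.sqrt d)⁻¹ : ℝ) : ℂ) = (((Real.sqrt d)⁻¹ : ℝ) : ℂ) :=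
      Complex.conj_ofReal _
    rw [h1, ← mul_assoc, hsq]
  have hL : ∀ (A : Matrix (Fin dA) (Fin dA) ℂ) (B : Matrix (Fin dB) (Fin dB) ℂ),
      pinner ((A ⊗ₖ B).mulVec ψ) ψ = (A * M * Bᵀ * Mᴴ).trace := by
    intro A B
    rw [pinner_trace]
    simp only [kron_mulVec]
    rfl
  have hz1 : ∀ v, P v * M * (1 - Q v)ᵀ = 0 := by
    intro v
    apply psd_zero (hP v).1 (hQ v).2
    have h := hcorr v v 0 1
    rw [hR] at h
    simp only [canonPair, if_true, if_neg (show (1 : Fin 2) ≠ 0 by decide)] at h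
    rw [h, Matrix.mul_sub, hPti, Matrix.mul_one, sub_self]; simp
  have hz2 : ∀ v, (1 - P v) * M * (Q v)ᵀ = 0 := by
    intro v
    apply psd_zero (hP v).2 (hQ v).1
    have h := hcorr v v 1 0
    rw [hR] at h
    simp only [canonPair, if_true, if_neg (show (1 : Fin 2) ≠ 0 by decide)] at h
    rw [h, Matrix.sub_mul, hPti, Matrix.one_mul, sub_self]; simp
  have hPMQ : ∀ v, P v * M * (Q v)ᵀ = P v * M := by
    intro v
    have := hz1 v
    rw [Matrix.transpose_sub, Matrix.transpose_one, Matrix.mul_sub, Matrix.mul_one, sub_eq_zero] at this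
    exact this.symm
  have hPM : ∀ v, P v * M = M * (Q v)ᵀ := by
    intro v
    have := hz2 v
    rw [Matrix.sub_mul, Matrix.sub_mul, Matrix.one_mul, sub_eq_zero, hPMQ] at this
    exact this.symm
  have hPPM : ∀ v, P v * (P v * M) = P v * M := by
    intro v
    conv_lhs => rw [hPM, ← Matrix.mul_assoc]
    exact hPMQ v
  have hMM : (M * Mᴴ).trace = 1 := by
    have h := (evnorm_one_iff ψ).1 hψ
    rw [← h]
    exact (pinner_trace ψ ψ).symm
  have h00 : ∀ v w, (P v * M * (Q w)ᵀ * Mᴴ).trace = (d : ℂ)⁻¹ * (Pt v * Pt w).trace := by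
    intro v w
    have h := hcorr v w 0 0
    rw [hR, hL] at h
    simpa only [canonPair, if_true] using h
  have htrPt : ((∑ v, Pt v).trace) = (x : ℂ) * d := by
    rw [hPtsum]; simp
  have hSM : (∑ v, P v) * M = (x : ℂ) • M := by
    have e1 : ((∑ v, P v) * M * Mᴴ).trace = x := by
      rw [Matrix.sum_mul, Matrix.sum_mul, Matrix.trace_sum]
      have : ∀ v, (P v * M * Mᴴ).trace = (d : ℂ)⁻¹ * (Pt v).trace := by
        intro v; rw [← hPMQ v, h00, hPti]
      simp only [this]
      rw [← Finset.mul_sum, ← Matrix.trace_sum, htrPt]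
      field_simp
    have e2 : ((∑ v, P v) * M * ((∑ v, P v) * M)ᴴ).trace = (x : ℂ) ^ 2 := by
      have a1 : (∑ v, P v) * M = M * ∑ v, (Q v)ᵀ := by
        rw [Matrix.sum_mul, Matrix.mul_sum]; exact Finset.sum_congr rfl fun v _ => hPM v
      have a2 : ((∑ v, P v) * M)ᴴ = ∑ w, (Q w)ᵀ * Mᴴ := by
        rw [a1, Matrix.conjTranspose_mul, Matrix.conjTranspose_sum, Matrix.sum_mul]
        simp only [hQh]
      rw [a2, Matrix.mul_sum, Matrix.trace_sum]
      have a3 : ∀ w, ((∑ v, P v) * M * ((Q w)ᵀ * Mᴴ)).trace = (d : ℂ)⁻¹ * ((x : ℂ) * (Pt w).trace) := by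
        intro w
        rw [Matrix.sum_mul, Matrix.sum_mul, Matrix.trace_sum]
        simp only [← Matrix.mul_assoc, h00]
        rw [← Finset.mul_sum, ← Matrix.trace_sum, ← Matrix.sum_mul, hPtsum]
        simp
      simp only [a3]
      rw [← Finset.mul_sum, ← Finset.mul_sum, ← Matrix.trace_sum, htrPt]
      field_simp
    have e3 : (M * ((∑ v, P v) * M)ᴴ).trace = x := by
      have := congrArg star e1
      rw [← Matrix.trace_conjTranspose, Matrix.conjTranspose_mul,
        Matrix.conjTranspose_conjTranspose] at this
      rw [this]; exact Complex.conj_ofReal _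
    rw [← sub_eq_zero, ← Matrix.trace_mul_conjTranspose_self_eq_zero_iff]
    have hxs : star (x : ℂ) = x := Complex.conj_ofReal _
    rw [Matrix.conjTranspose_sub, Matrix.conjTranspose_smul, hxs, Matrix.sub_mul, Matrix.mul_sub,
      Matrix.mul_sub, Matrix.trace_sub, Matrix.trace_sub, Matrix.trace_sub, e2]
    simp only [Matrix.smul_mul, Matrix.mul_smul, Matrix.trace_smul, e1, e3, hMM, smul_eq_mul]
    ring
  have hQM : ∀ v, (Q v)ᵀ * Mᴴ = Mᴴ * P v := by
    intro v
    have := congrArg Matrix.conjTranspose (hPM v)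
    rw [Matrix.conjTranspose_mul, Matrix.conjTranspose_mul, hQh, hPh] at this
    exact this.symm
  obtain ⟨k, X, hX1, hX2, hX3⟩ := decompM hd hU Pt hPth hPti hPtsum hS P hPh M
    (fun v => (Q v)ᵀ) hPM hPPM hSM
  obtain ⟨l, Y, hY1, hY2, hY3⟩ := decompM hd hU Pt hPth hPti hPtsum hS (fun v => (Q v)ᵀ) hQh Mᴴ
    P hQM
    (by
      intro v
      have := congrArg Matrix.conjTranspose (hPPM v)
      simp only [Matrix.conjTranspose_mul, hPh] at this
      rw [hQM, ← Matrix.mul_assoc, hQM, this])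
    (by
      have := congrArg Matrix.conjTranspose hSM
      rw [Matrix.conjTranspose_mul, Matrix.conjTranspose_sum, Matrix.conjTranspose_smul] at this
      simp only [hPh] at this
      rw [Matrix.mul_sum] at this
      rw [Matrix.sum_mul]
      simp only [hQM]
      rw [this]
      congr 1
      exact Complex.conj_ofReal _)
  have hX2' : ∀ v i, (X i)ᴴ * P v = Pt v * (X i)ᴴ := by
    intro v i
    have := congrArg Matrix.conjTranspose (hX2 v i)
    rwa [Matrix.conjTranspose_mul, Matrix.conjTranspose_mul, hPh, hPth] at this
  have hY2' : ∀ v i, (Y i)ᴴ * (Q v)ᵀ = Pt v * (Y i)ᴴ := by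
    intro v i
    have := congrArg Matrix.conjTranspose (hY2 v i)
    rwa [Matrix.conjTranspose_mul, Matrix.conjTranspose_mul, hQh, hPth] at this
  have hcx : ∀ i j, ∃ c : ℂ, (X i)ᴴ * M * Y j = c • 1 := by
    intro i j
    apply hS
    intro v
    rw [← Matrix.mul_assoc, ← Matrix.mul_assoc, ← hX2', Matrix.mul_assoc _ (P v), hPM,
      ← Matrix.mul_assoc, Matrix.mul_assoc, hY2, ← Matrix.mul_assoc]
  choose c hc using hcx
  have hMd : M = ∑ i, ∑ j, c i j • (X i * (Y j)ᴴ) := by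
    have h1 : M = ∑ j, M * Y j * (Y j)ᴴ := by
      have := congrArg Matrix.conjTranspose hY3
      rw [Matrix.conjTranspose_sum] at this
      simpa only [Matrix.conjTranspose_mul, Matrix.conjTranspose_conjTranspose] using this
    conv_lhs => rw [hX3]
    refine Finset.sum_congr rfl fun i _ => ?_
    conv_lhs => rw [h1]
    rw [Matrix.mul_sum, Matrix.mul_sum]
    refine Finset.sum_congr rfl fun j _ => ?_
    rw [← Matrix.mul_assoc (X i)ᴴ, ← Matrix.mul_assoc (X i)ᴴ, hc]
    simp
  obtain ⟨kA, VA, eA, hVA, hVAX⟩ := iso_ext hd X hX1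
  obtain ⟨kB, VB, eB, hVB, hVBY⟩ := iso_ext hd (fun j => ((Y j)ᴴ)ᵀ) (by
    intro i j
    have := congrArg Matrix.transpose (hY1 j i)
    rw [Matrix.transpose_mul] at this
    have h2 : (((Y i)ᴴ)ᵀ)ᴴ = (Y i)ᵀ := by
      ext a b; simp
    rw [h2, this]
    by_cases hij : i = j
    · simp [hij]
    · simp [hij, Ne.symm hij])
  let χ : Fin kA × Fin kB → ℂ := fun y =>
    ((Real.sqrt d : ℝ) : ℂ) * ∑ i, ∑ j, c i j * (if y.1 = eA i ∧ y.2 = eB j then 1 else 0)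
  have main : ∀ (G H : Matrix (Fin d) (Fin d) ℂ) (A : Matrix (Fin dA) (Fin dA) ℂ)
      (B : Matrix (Fin dB) (Fin dB) ℂ), (∀ i, A * X i = X i * G) →
      (∀ j, (Y j)ᴴ * Bᵀ = H * (Y j)ᴴ) → ∀ p q, (VA * (A * M * Bᵀ) * VBᵀ) p q =
        ((((Real.sqrt d)⁻¹ : ℝ) : ℂ) * (G * H) p.1 q.1) * χ (p.2, q.2) := by
    intro G H A B hA hB p q
    have e1 : VA * (A * M * Bᵀ) * VBᵀ =
        ∑ i, ∑ j, c i j • ((VA * X i) * (G * H) * (VB * ((Y j)ᴴ)ᵀ)ᵀ) := by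
      rw [hMd]
      simp only [Matrix.mul_sum, Matrix.sum_mul, Matrix.mul_smul, Matrix.smul_mul]
      refine Finset.sum_congr rfl fun i _ => Finset.sum_congr rfl fun j _ => ?_
      congr 1
      have : A * (X i * (Y j)ᴴ) * Bᵀ = X i * (G * H) * (Y j)ᴴ := by
        rw [← Matrix.mul_assoc, hA, Matrix.mul_assoc, hB]
        simp only [Matrix.mul_assoc]
      rw [this, Matrix.transpose_mul, Matrix.transpose_transpose]
      simp only [Matrix.mul_assoc]
    rw [e1]
    simp only [hVAX, hVBY, Matrix.sum_apply, Matrix.smul_apply, JGJ, smul_eq_mul, χ]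
    have h0 : ((Real.sqrt d : ℝ) : ℂ) ≠ 0 := by
      have : Real.sqrt d ≠ 0 := by
        rw [Ne, Real.sqrt_eq_zero (Nat.cast_nonneg d)]; exact hd0
      exact_mod_cast this
    have h1 : ∀ g s : ℂ, ((((Real.sqrt d)⁻¹ : ℝ) : ℂ) * g) * (((Real.sqrt d : ℝ) : ℂ) * s) = g * s := by
      intro g s; push_cast; field_simp
    rw [h1]
    simp only [Finset.mul_sum]
    refine Finset.sum_congr rfl fun i _ => Finset.sum_congr rfl fun j _ => ?_
    ring
  have main1 := main 1 1 1 1 (by simp) (by simp)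
  simp only [Matrix.transpose_one, Matrix.mul_one, Matrix.one_mul] at main1
  refine ⟨kA, kB, VA, VB, χ, hVA, hVB, ?_, ?_, ?_⟩
  · rw [evnorm_one_iff]
    have t1 : ((VA * M * VBᵀ) * (VA * M * VBᵀ)ᴴ).trace = 1 := by
      have h1 : VBᵀ * (VBᵀ)ᴴ = 1 := by
        have := congrArg Matrix.transpose hVB
        rw [Matrix.transpose_mul, Matrix.transpose_one] at this
        rw [← this]; rfl
      rw [Matrix.conjTranspose_mul, Matrix.mul_assoc, ← Matrix.mul_assoc VBᵀ, h1, Matrix.one_mul,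
        Matrix.conjTranspose_mul, ← Matrix.mul_assoc, Matrix.trace_mul_comm, ← Matrix.mul_assoc,
        ← Matrix.mul_assoc, hVA, Matrix.one_mul, hMM]
    rw [← t1]
    have hr : (starRingEnd ℂ) (((Real.sqrt d)⁻¹ : ℝ) : ℂ) = (((Real.sqrt d)⁻¹ : ℝ) : ℂ) :=
      Complex.conj_ofReal _
    have t2 : ∀ p q, (VA * M * VBᵀ) p q * star ((VA * M * VBᵀ) p q) =
        (if p.1 = q.1 then (d : ℂ)⁻¹ else 0) *
          (χ (p.2, q.2) * (starRingEnd ℂ) (χ (p.2, q.2))) := by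
      intro p q
      rw [main1, ← starRingEnd_apply, map_mul, map_mul, hr, ← hsq]
      by_cases h : p.1 = q.1
      · rw [h, Matrix.one_apply_eq, if_pos rfl, map_one]; ring
      · simp [h, Matrix.one_apply_ne h]
    simp only [Matrix.trace, Matrix.diag_apply, Matrix.mul_apply (N := (VA * M * VBᵀ)ᴴ),
      Matrix.conjTranspose_apply, t2, Fintype.sum_prod_type]
    have t3 : ∀ (s : Fin d) (m : Fin kA), ∑ t : Fin d, ∑ m' : Fin kB,
        (if s = t then (d : ℂ)⁻¹ else 0) * (χ (m, m') * (starRingEnd ℂ) (χ (m, m'))) =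
        (d : ℂ)⁻¹ * ∑ m' : Fin kB, (χ (m, m') * (starRingEnd ℂ) (χ (m, m'))) := by
      intro s m
      rw [Finset.sum_eq_single s]
      · simp only [if_true, Finset.mul_sum]
      · intro b _ hb; simp [Ne.symm hb]
      · simp
    simp only [t3]
    rw [Finset.sum_const, ← Finset.mul_sum]
    simp only [Finset.card_univ, Fintype.card_fin, nsmul_eq_mul]
    rw [← mul_assoc, mul_inv_cancel₀ hdc, one_mul]
  · apply le_of_eq
    have : (fun y : (Fin d × Fin d) × (Fin kA × Fin kB) =>
        ((VA ⊗ₖ VB).mulVec ψ) ((y.1.1, y.2.1), (y.1.2, y.2.2)) - phid d y.1 * χ y.2) =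
        fun _ => 0 := by
      funext y
      rw [kron_mulVec, main1, sub_eq_zero]
      congr 1
      simp [phid, Matrix.one_apply]
    rw [this]; simp [evnorm]
  · intro v w i j
    apply le_of_eq
    have : (fun y : (Fin d × Fin d) × (Fin kA × Fin kB) =>
        ((VA ⊗ₖ VB).mulVec ((canonPair (P v) i ⊗ₖ canonPair (Q w) j).mulVec ψ))
          ((y.1.1, y.2.1), (y.1.2, y.2.2)) -
        ((canonPair (Pt v) i ⊗ₖ canonPair ((Pt w)ᵀ) j).mulVec (phid d)) y.1 * χ y.2) =
        fun _ => 0 := by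
      funext ⟨⟨s, t⟩, m⟩
      rw [kron_mulVec, kron_mulVec]
      simp only [kron_mulVec (ι := Fin dA)]
      have h1 := main (canonPair (Pt v) i) (canonPair (Pt w) j) (canonPair (P v) i)
        (canonPair (Q w) j) (fun a => canon_mul (hX2 v a) i)
        (fun a => by rw [canon_transpose]; exact canon_mul' (hY2' w a) j) (s, m.1) (t, m.2)
      have h2 : ∀ N : Matrix (Fin dA) (Fin dB) ℂ, (Matrix.of fun i j => N i j) = N := fun N => rfl
      rw [h2, h1, phid_mat, canon_transpose, Matrix.transpose_transpose, sub_eq_zero]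
      simp
    rw [this]; simp [evnorm]
end QST
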